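/- Let A₁,…,A_m be positive semidefinite n×n complex matrices, let Z₁,…,Z_m be expansive n×n complex matrices (i.e. Zᵢ*Zᵢ ≥ I), and let p > 1 be a real number. Then Tr ∑ᵢ Zᵢ*Aᵢᵖ Zᵢ ≤ Tr (∑ᵢ Zᵢ*AᵢZᵢ)ᵖ. -/

import Mathlib

open Matrix ComplexOrder

/-- `f(A)` for a Hermitian matrix `A`: apply `f` to the eigenvalues in a spectral
decomposition of `A`. -/
noncomputable def matFn {n : ℕ} (f : ℝ → ℝ) (A : Matrix (Fin n) (Fin n) ℂ)
    (hA : A.IsHermitian) : Matrix (Fin n) (Fin n) ℂ :=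
  (hA.eigenvectorUnitary : Matrix (Fin n) (Fin n) ℂ) *
    Matrix.diagonal (fun i => (f (hA.eigenvalues i) : ℂ)) *
    (star hA.eigenvectorUnitary : Matrix (Fin n) (Fin n) ℂ)

theorem matFn_isHermitian {n : ℕ} (f : ℝ → ℝ) (A : Matrix (Fin n) (Fin n) ℂ)
    (hA : A.IsHermitian) : (matFn f A hA).IsHermitian := by
  have h1 : (Matrix.diagonal (fun i => (f (hA.eigenvalues i) : ℂ))).IsHermitian :=
    Matrix.isHermitian_diagonal_of_self_adjoint _ (by ext i; simp [Pi.star_def])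
  have h2 := Matrix.isHermitian_mul_mul_conjTranspose
    (hA.eigenvectorUnitary : Matrix (Fin n) (Fin n) ℂ) h1
  simpa [matFn, Matrix.star_eq_conjTranspose] using h2

/-- The sum of the `k` largest entries of `μ` (for the eigenvalue vector of a Hermitian
matrix, this is the Ky Fan `k`-sum of its eigenvalues). -/
noncomputable def sumKLargest {n : ℕ} (μ : Fin n → ℝ) (k : ℕ) : ℝ :=
  (((List.ofFn μ).insertionSort (· ≥ ·)).take k).sum

theorem isHermitian_sum_conj {n m : ℕ} (A Z : Fin m → Matrix (Fin n) (Fin n) ℂ)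
    (hA : ∀ i, (A i).IsHermitian) : (∑ i, (Z i)ᴴ * A i * Z i).IsHermitian := by
  rw [Matrix.IsHermitian, Matrix.conjTranspose_sum]
  exact Finset.sum_congr rfl fun i _ =>
    Matrix.isHermitian_conjTranspose_mul_mul (Z i) (hA i)

/-- If `Z` is expansive, then so is `Zᴴ`. -/
theorem posSemidef_mul_conjTranspose_sub_one {ι : Type*} [Fintype ι] [DecidableEq ι]
    {Z : Matrix ι ι ℂ} (hZ : (Zᴴ * Z - 1).PosSemidef) : (Z * Zᴴ - 1).PosSemidef := by
  have hpos : (Zᴴ * Z).PosDef := by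
    simpa using (Matrix.PosDef.one (n := ι) (R := ℂ)).add_posSemidef hZ
  have hdet : IsUnit Z.det := by
    have h := (Matrix.isUnit_iff_isUnit_det _).1 hpos.isUnit
    rw [Matrix.det_mul] at h
    exact isUnit_of_mul_isUnit_right h
  have h1 : Z * Z⁻¹ = 1 := Matrix.mul_nonsing_inv _ hdet
  have h2 : Z⁻¹ᴴ * Zᴴ = 1 := by rw [← Matrix.conjTranspose_mul, h1, Matrix.conjTranspose_one]
  have key : Z * Zᴴ - 1 =
      (Zᴴ - Z⁻¹)ᴴ * (Zᴴ - Z⁻¹) + Z⁻¹ᴴ * (Zᴴ * Z - 1) * Z⁻¹ := by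
    have h3 : Z⁻¹ᴴ * (Zᴴ * Z - 1) * Z⁻¹ = 1 - Z⁻¹ᴴ * Z⁻¹ := by
      rw [Matrix.mul_sub, Matrix.sub_mul, ← Matrix.mul_assoc, h2, Matrix.one_mul, h1,
        Matrix.mul_one]
    rw [h3, Matrix.conjTranspose_sub, Matrix.conjTranspose_conjTranspose, Matrix.sub_mul,
      Matrix.mul_sub, Matrix.mul_sub, h1, h2]
    abel
  rw [key]
  exact (Matrix.posSemidef_conjTranspose_mul_self _).add (hZ.conjTranspose_mul_mul_same _)

/-- Jensen's inequality for `x ↦ x ^ p` with subprobability weights. -/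
theorem rpow_sum_le_sum_mul_rpow {ι : Type*} (s : Finset ι) (d x : ι → ℝ)
    (hd : ∀ i ∈ s, 0 ≤ d i) (hx : ∀ i ∈ s, 0 ≤ x i) (hsum : ∑ i ∈ s, d i ≤ 1)
    {p : ℝ} (hp : 1 < p) :
    (∑ i ∈ s, d i * x i) ^ p ≤ ∑ i ∈ s, d i * x i ^ p := by
  set t := ∑ i ∈ s, d i * x i with ht
  have ht0 : 0 ≤ t := Finset.sum_nonneg fun i hi => mul_nonneg (hd i hi) (hx i hi)
  have hp0 : 0 < p := by linarith
  have hpq := Real.HolderConjugate.conjExponent hp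
  have hq0 : 0 < Real.conjExponent p := hpq.symm.pos
  have htp : (t ^ (p - 1)) ^ Real.conjExponent p = t ^ p := by
    rw [← Real.rpow_mul ht0, hpq.sub_one_mul_conj]
  have htt : t * t ^ (p - 1) = t ^ p := by
    rw [← Real.rpow_one_add' ht0 (by linarith)]
    congr 1
    ring
  have hyoung : t ^ p ≤ (∑ i ∈ s, d i * x i ^ p) / p +
      (∑ i ∈ s, d i) * (t ^ p / Real.conjExponent p) := by
    calc t ^ p = ∑ i ∈ s, d i * (x i * t ^ (p - 1)) := by
          rw [← htt, ht, Finset.sum_mul]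
          exact Finset.sum_congr rfl fun i _ => by ring
      _ ≤ ∑ i ∈ s, d i * (x i ^ p / p + t ^ p / Real.conjExponent p) := by
          refine Finset.sum_le_sum fun i hi => mul_le_mul_of_nonneg_left ?_ (hd i hi)
          have h := Real.young_inequality_of_nonneg (hx i hi) (Real.rpow_nonneg ht0 (p - 1)) hpq
          rwa [htp] at h
      _ = _ := by
          simp only [mul_add, Finset.sum_add_distrib, Finset.sum_mul, Finset.sum_div, mul_div_assoc]
  have hle : (∑ i ∈ s, d i) * (t ^ p / Real.conjExponent p) ≤ t ^ p / Real.conjExponent p :=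
    mul_le_of_le_one_left (by positivity) hsum
  have hsplit : t ^ p / Real.conjExponent p = t ^ p - t ^ p / p := by
    have h := hpq.inv_add_inv_eq_one
    rw [div_eq_mul_inv, div_eq_mul_inv, show (Real.conjExponent p)⁻¹ = 1 - p⁻¹ by linarith]
    ring
  have : t ^ p / p ≤ (∑ i ∈ s, d i * x i ^ p) / p := by linarith
  exact (div_le_div_iff_of_pos_right hp0).1 this

/-- A matrix with orthogonal rows of squared norms `d` satisfies
`∑ⱼ ‖colⱼ‖ ^ (2 * p) ≤ ∑ₗ d l ^ p`. -/
theorem sum_colNormSq_rpow_le {L J : Type*} [Fintype L] [Fintype J] [DecidableEq L]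
    (X : Matrix L J ℂ) (d : L → ℝ) (h : X * Xᴴ = Matrix.diagonal fun l => (d l : ℂ))
    {p : ℝ} (hp : 1 < p) :
    ∑ j, (∑ l, ‖X l j‖ ^ 2) ^ p ≤ ∑ l, d l ^ p := by
  have hd : ∀ l, ∑ j, ‖X l j‖ ^ 2 = d l := by
    intro l
    have := congrFun (congrFun h l) l
    simp only [Matrix.mul_apply, Matrix.conjTranspose_apply, Matrix.diagonal_apply_eq,
      RCLike.star_def, Complex.mul_conj'] at this
    exact_mod_cast this
  have hd0 : ∀ l, 0 ≤ d l := fun l => hd l ▸ Finset.sum_nonneg fun j _ => by positivity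
  have hX : ∀ l j, ‖X l j‖ ^ 2 / d l * d l = ‖X l j‖ ^ 2 := by
    intro l j
    refine div_mul_cancel_of_imp fun hl => ?_
    have := hd l
    rw [hl, Finset.sum_eq_zero_iff_of_nonneg fun j _ => by positivity] at this
    exact this j (Finset.mem_univ j)
  set E : Matrix L L ℂ := Matrix.diagonal fun l => ((d l)⁻¹ : ℂ) with hE
  set M : Matrix J J ℂ := Xᴴ * E * X with hM
  have hEE : E * Matrix.diagonal (fun l => (d l : ℂ)) * E = E := by
    simp only [hE, Matrix.diagonal_mul_diagonal]
    congr 1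
    ext l
    rcases eq_or_ne (d l : ℂ) 0 with hl | hl
    · simp [hl]
    · rw [inv_mul_cancel₀ hl, one_mul]
  have hMM : M * M = M := by
    calc M * M = Xᴴ * (E * (X * Xᴴ) * E) * X := by simp only [hM, Matrix.mul_assoc]
      _ = M := by rw [h, hEE]
  have hMh : Mᴴ = M := by
    have : Eᴴ = E := by
      rw [hE, Matrix.diagonal_conjTranspose]
      congr 1
      ext l
      simp
    simp only [hM, Matrix.conjTranspose_mul, Matrix.conjTranspose_conjTranspose, this,
      Matrix.mul_assoc]
  have hMjj : ∀ j, M j j = ((∑ l, ‖X l j‖ ^ 2 / d l : ℝ) : ℂ) := by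
    intro j
    rw [hM, Matrix.mul_apply]
    simp only [hE, Matrix.mul_diagonal, Matrix.conjTranspose_apply, RCLike.star_def]
    push_cast
    refine Finset.sum_congr rfl fun l _ => ?_
    rw [mul_right_comm, Complex.conj_mul', div_eq_mul_inv]
  have hweight : ∀ j, ∑ l, ‖X l j‖ ^ 2 / d l ≤ 1 := by
    intro j
    set q := ∑ l, ‖X l j‖ ^ 2 / d l with hq
    have h1 : q = ∑ k, ‖M j k‖ ^ 2 := by
      have h2 := congrFun (congrFun hMM j) j
      rw [hMjj j] at h2
      nth_rewrite 2 [← hMh] at h2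
      simp only [Matrix.mul_apply, Matrix.conjTranspose_apply, RCLike.star_def,
        Complex.mul_conj'] at h2
      exact_mod_cast h2.symm
    have h3 : q ^ 2 ≤ q := by
      have h4 : ‖M j j‖ ^ 2 ≤ ∑ k, ‖M j k‖ ^ 2 :=
        Finset.single_le_sum (f := fun k => ‖M j k‖ ^ 2) (fun k _ => by positivity)
          (Finset.mem_univ j)
      rw [← h1, hMjj j, Complex.norm_real, Real.norm_eq_abs, sq_abs] at h4
      exact h4
    nlinarith
  calc ∑ j, (∑ l, ‖X l j‖ ^ 2) ^ p = ∑ j, (∑ l, ‖X l j‖ ^ 2 / d l * d l) ^ p := by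
        simp only [hX]
    _ ≤ ∑ j, ∑ l, ‖X l j‖ ^ 2 / d l * d l ^ p :=
        Finset.sum_le_sum fun j _ => rpow_sum_le_sum_mul_rpow _ _ _
          (fun l _ => div_nonneg (by positivity) (hd0 l)) (fun l _ => hd0 l) (hweight j) hp
    _ = ∑ l, d l ^ p := by
        rw [Finset.sum_comm]
        refine Finset.sum_congr rfl fun l _ => ?_
        rw [← Finset.sum_mul, ← Finset.sum_div, hd]
        rcases eq_or_ne (d l) 0 with hl | hl
        · rw [hl, Real.zero_rpow (by linarith), mul_zero]
        · rw [div_self hl, one_mul]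

theorem matFn_id {n : ℕ} (A : Matrix (Fin n) (Fin n) ℂ) (hA : A.IsHermitian) :
    matFn (fun x => x) A hA = A :=
  hA.spectral_theorem.symm

theorem trace_mul_diagonal_mul_conjTranspose {L K : Type*} [Fintype L] [Fintype K]
    [DecidableEq K] (C : Matrix L K ℂ) (a : K → ℝ) :
    (C * Matrix.diagonal (fun k => (a k : ℂ)) * Cᴴ).trace =
      ((∑ k, a k * ∑ l, ‖C l k‖ ^ 2 : ℝ) : ℂ) := by
  simp only [Matrix.trace, Matrix.diag_apply, Matrix.mul_apply (N := Cᴴ), Matrix.mul_diagonal,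
    Matrix.conjTranspose_apply, RCLike.star_def]
  rw [Finset.sum_comm]
  push_cast
  refine Finset.sum_congr rfl fun k _ => ?_
  rw [Finset.mul_sum]
  refine Finset.sum_congr rfl fun l _ => ?_
  rw [mul_right_comm, Complex.mul_conj', mul_comm]

theorem trace_matFn {n : ℕ} (f : ℝ → ℝ) (A : Matrix (Fin n) (Fin n) ℂ) (hA : A.IsHermitian) :
    (matFn f A hA).trace = ((∑ i, f (hA.eigenvalues i) : ℝ) : ℂ) := by
  rw [matFn, Matrix.trace_mul_cycle, Unitary.coe_star_mul_self, Matrix.one_mul,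
    Matrix.trace_diagonal]
  push_cast
  rfl

/-- Theorem 1.1, trace form: for positive semidefinite `Aᵢ`, expansive `Zᵢ` and `p > 1`,
`Tr ∑ Zᵢ* Aᵢ^p Zᵢ ≤ Tr (∑ Zᵢ* Aᵢ Zᵢ)^p`. -/
theorem trace_rpow_sum_congruence {n m : ℕ} (A Z : Fin m → Matrix (Fin n) (Fin n) ℂ)
    (hA : ∀ i, (A i).PosSemidef)
    (hZ : ∀ i, ((Z i)ᴴ * Z i - 1).PosSemidef)
    (p : ℝ) (hp : 1 < p) :
    (∑ i, (Z i)ᴴ * matFn (fun x => x ^ p) (A i) (hA i).1 * Z i).trace ≤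
    (matFn (fun x => x ^ p) _ (isHermitian_sum_conj A Z fun i => (hA i).1)).trace := by
  have hS := isHermitian_sum_conj A Z fun i => (hA i).1
  set S := ∑ i, (Z i)ᴴ * A i * Z i with hSdef
  set V : Matrix (Fin n) (Fin n) ℂ :=
    (hS.eigenvectorUnitary : Matrix (Fin n) (Fin n) ℂ)
  have hVV : V * Vᴴ = 1 := Unitary.coe_mul_star_self hS.eigenvectorUnitary
  have hVV' : Vᴴ * V = 1 := Unitary.coe_star_mul_self hS.eigenvectorUnitary
  set U : Fin m → Matrix (Fin n) (Fin n) ℂ := fun i => (hA i).1.eigenvectorUnitary with hU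
  have hUU : ∀ i, (U i)ᴴ * U i = 1 := fun i =>
    Unitary.coe_star_mul_self (hA i).1.eigenvectorUnitary
  set a : Fin m → Fin n → ℝ := fun i => (hA i).1.eigenvalues with ha
  have ha0 : ∀ i k, 0 ≤ a i k := fun i => (hA i).eigenvalues_nonneg
  set C : Fin m → Matrix (Fin n) (Fin n) ℂ := fun i => Vᴴ * (Z i)ᴴ * U i with hC
  have hconj : ∀ (f : ℝ → ℝ) i, Vᴴ * ((Z i)ᴴ * matFn f (A i) (hA i).1 * Z i) * V =
      C i * Matrix.diagonal (fun k => (f (a i k) : ℂ)) * (C i)ᴴ := by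
    intro f i
    simp only [matFn, hC, hU, ha, Matrix.conjTranspose_mul, Matrix.conjTranspose_conjTranspose,
      Matrix.mul_assoc, Matrix.star_eq_conjTranspose]
  have hw : ∀ i k, 1 ≤ ∑ l, ‖C i l k‖ ^ 2 := by
    intro i k
    have h1 := (posSemidef_mul_conjTranspose_sub_one (hZ i)).conjTranspose_mul_mul_same (U i)
    have h2 : (U i)ᴴ * (Z i * (Z i)ᴴ - 1) * U i = (C i)ᴴ * C i - 1 := by
      have h3 : (C i)ᴴ * C i = (U i)ᴴ * (Z i * (V * Vᴴ) * (Z i)ᴴ) * U i := by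
        simp only [hC, Matrix.conjTranspose_mul, Matrix.conjTranspose_conjTranspose,
          Matrix.mul_assoc]
      rw [h3, hVV, Matrix.mul_one, Matrix.mul_sub, Matrix.sub_mul, Matrix.mul_one, hUU]
    rw [h2] at h1
    have h4 := h1.diag_nonneg (i := k)
    simp only [Matrix.sub_apply, Matrix.one_apply_eq, Matrix.mul_apply,
      Matrix.conjTranspose_apply, RCLike.star_def, Complex.conj_mul', sub_nonneg] at h4
    exact_mod_cast h4
  set X : Matrix (Fin n) (Fin m × Fin n) ℂ :=
    Matrix.of fun l j => (√(a j.1 j.2) : ℂ) * C j.1 l j.2 with hX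
  have hXX : X * Xᴴ = Matrix.diagonal fun l => (hS.eigenvalues l : ℂ) := by
    have h1 : Vᴴ * S * V = Matrix.diagonal fun l => (hS.eigenvalues l : ℂ) := by
      have h2 : V * Matrix.diagonal (fun l => (hS.eigenvalues l : ℂ)) * Vᴴ = S :=
        matFn_id S hS
      conv_lhs => rw [← h2]
      calc _ = (Vᴴ * V) * Matrix.diagonal (fun l => (hS.eigenvalues l : ℂ)) * (Vᴴ * V) := by
            simp only [Matrix.mul_assoc]
        _ = _ := by rw [hVV', Matrix.one_mul, Matrix.mul_one]
    have h3 : Vᴴ * S * V =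
        ∑ i, C i * Matrix.diagonal (fun k => (a i k : ℂ)) * (C i)ᴴ := by
      rw [hSdef, Matrix.mul_sum, Matrix.sum_mul]
      refine Finset.sum_congr rfl fun i _ => ?_
      rw [← hconj (fun x => x) i, matFn_id]
    rw [← h1, h3]
    ext l l'
    simp only [hX, Matrix.sum_apply, Matrix.mul_apply (N := Matrix.conjTranspose _),
      Matrix.mul_diagonal, Matrix.of_apply,
      Matrix.conjTranspose_apply, Fintype.sum_prod_type, star_mul', RCLike.star_def,
      Complex.conj_ofReal]
    refine Finset.sum_congr rfl fun i _ => Finset.sum_congr rfl fun k _ => ?_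
    have h4 : (√(a i k) : ℂ) * √(a i k) = a i k := by
      exact_mod_cast Real.mul_self_sqrt (ha0 i k)
    rw [← h4]
    ring
  have hmain := sum_colNormSq_rpow_le X hS.eigenvalues hXX hp
  have hcol : ∀ i k, ∑ l, ‖X l (i, k)‖ ^ 2 = a i k * ∑ l, ‖C i l k‖ ^ 2 := by
    intro i k
    rw [Finset.mul_sum]
    refine Finset.sum_congr rfl fun l _ => ?_
    simp only [hX, Matrix.of_apply, norm_mul, mul_pow, Complex.norm_real, Real.norm_eq_abs,
      sq_abs, Real.sq_sqrt (ha0 i k)]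
  have hleft : (∑ i, (Z i)ᴴ * matFn (fun x => x ^ p) (A i) (hA i).1 * Z i).trace =
      ((∑ i, ∑ k, a i k ^ p * ∑ l, ‖C i l k‖ ^ 2 : ℝ) : ℂ) := by
    rw [Matrix.trace_sum, Complex.ofReal_sum]
    refine Finset.sum_congr rfl fun i _ => ?_
    rw [← trace_mul_diagonal_mul_conjTranspose, ← hconj (fun x => x ^ p) i,
      Matrix.trace_mul_cycle Vᴴ, hVV, Matrix.one_mul]
  rw [hleft, trace_matFn, Complex.real_le_real]
  refine le_trans ?_ hmain
  rw [Fintype.sum_prod_type]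
  refine Finset.sum_le_sum fun i _ => Finset.sum_le_sum fun k _ => ?_
  rw [hcol, Real.mul_rpow (ha0 i k) (zero_le_one.trans (hw i k))]
  exact mul_le_mul_of_nonneg_left (Real.self_le_rpow_of_one_le (hw i k) hp.le)
    (Real.rpow_nonneg (ha0 i k) p)
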